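/- arXiv:2101.03739 — 2 statements merged into one kernel-verified Lean document; each statement's English description precedes it below -/
import Mathlib

section
/- SOL^w(K_∞, f^∞) = {0} if and only if SOL(K_∞, f_i^∞) = {0} for every i ∈ {1, …, s}. -/
open Filter Topology MvPolynomial

/-- The asymptotic cone of a set `K ⊆ ℝⁿ`:
`K_∞ = {v : ∃ t_k → +∞, x_k ∈ K with x_k / t_k → v}`. -/
def asympCone {n : ℕ} (K : Set (Fin n → ℝ)) : Set (Fin n → ℝ) :=
  {v | ∃ (t : ℕ → ℝ) (x : ℕ → (Fin n → ℝ)), (∀ k, x k ∈ K) ∧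
    Tendsto t atTop atTop ∧ Tendsto (fun k => (t k)⁻¹ • x k) atTop (nhds v)}

/-- The weak Pareto efficient solution set of the vector function `p` on `C`:
`x* ∈ C` such that for no `x ∈ C` we have `p(x) - p(x*) ∈ -int ℝˢ₊`. -/
def SOLw {n s : ℕ} (C : Set (Fin n → ℝ)) (p : Fin s → (Fin n → ℝ) → ℝ) : Set (Fin n → ℝ) :=
  {x | x ∈ C ∧ ∀ y ∈ C, ¬ (∀ i, p i y < p i x)}

/-- The Pareto efficient solution set of the vector function `p` on `C`:
`x* ∈ C` such that for no `x ∈ C` we have `p(x) - p(x*) ∈ -ℝˢ₊ \ {0}`. -/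
def SOLs {n s : ℕ} (C : Set (Fin n → ℝ)) (p : Fin s → (Fin n → ℝ) → ℝ) : Set (Fin n → ℝ) :=
  {x | x ∈ C ∧ ∀ y ∈ C, ¬ ((∀ i, p i y ≤ p i x) ∧ (∃ i, p i y < p i x))}

/-- The set of global minimizers of the scalar function `q` on `C`. -/
def SOLmin {n : ℕ} (C : Set (Fin n → ℝ)) (q : (Fin n → ℝ) → ℝ) : Set (Fin n → ℝ) :=
  {x | x ∈ C ∧ ∀ y ∈ C, q x ≤ q y}

/-- The recession polynomial (vector leading term) of `p`, as a function:
`p^∞(x) = lim_{λ→+∞} p(λx)/λ^{deg p}`, i.e. the evaluation of the homogeneous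
component of `p` of top degree. -/
noncomputable def recFn {n : ℕ} (p : MvPolynomial (Fin n) ℝ) : (Fin n → ℝ) → ℝ :=
  fun x => eval x (homogeneousComponent p.totalDegree p)

/-- Evaluation of a polynomial, as a function `ℝⁿ → ℝ`. -/
noncomputable def evalFn {n : ℕ} (p : MvPolynomial (Fin n) ℝ) : (Fin n → ℝ) → ℝ :=
  fun x => eval x p

/-- `⟨∇p^∞(x), y⟩`: the inner product of the gradient of the recession polynomial
of `p` at `x` with `y`. -/
noncomputable def gradRecInner {n : ℕ} (p : MvPolynomial (Fin n) ℝ) (x y : Fin n → ℝ) : ℝ :=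
  ∑ j, (eval x (pderiv j (homogeneousComponent p.totalDegree p))) * y j

/-- `x` is a solution of the weak vector complementarity problem
`WVCP(C, ∇f^∞)`. -/
def isWVCPsol {n s : ℕ} (C : Set (Fin n → ℝ)) (f : Fin s → MvPolynomial (Fin n) ℝ)
    (x : Fin n → ℝ) : Prop :=
  x ∈ C ∧ (∀ y ∈ C, ¬ (∀ i, gradRecInner (f i) x y < 0)) ∧
    ¬ (∀ i, 0 < gradRecInner (f i) x x)

theorem mem_asympCone_iff {n : ℕ} (K : Set (Fin n → ℝ)) (v : Fin n → ℝ) :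
    v ∈ asympCone K ↔ ∀ ε > 0, ∀ T : ℝ, ∃ t ≥ T, ∃ x ∈ K, dist (t⁻¹ • x) v < ε := by
  constructor
  · rintro ⟨t, x, hx, ht, hl⟩ ε hε T
    obtain ⟨k, h1, h2⟩ := ((ht.eventually_ge_atTop T).and
      (Metric.tendsto_nhds.1 hl ε hε)).exists
    exact ⟨t k, h1, x k, hx k, h2⟩
  · intro h
    choose t ht x hx hd using fun k : ℕ => h (1 / ((k : ℝ) + 1)) (by positivity) (k : ℝ)
    refine ⟨t, x, hx, tendsto_atTop_mono ht tendsto_natCast_atTop_atTop, ?_⟩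
    rw [tendsto_iff_dist_tendsto_zero]
    exact squeeze_zero (fun _ => dist_nonneg) (fun k => (hd k).le)
      tendsto_one_div_add_atTop_nhds_zero_nat

theorem isClosed_asympCone {n : ℕ} (K : Set (Fin n → ℝ)) : IsClosed (asympCone K) := by
  apply isClosed_of_closure_subset
  intro v hv
  rw [mem_asympCone_iff]
  intro ε hε T
  obtain ⟨w, hw, hd⟩ := Metric.mem_closure_iff.1 hv (ε / 2) (by positivity)
  obtain ⟨t, ht, x, hx, h⟩ := (mem_asympCone_iff K w).1 hw (ε / 2) (by positivity) T
  refine ⟨t, ht, x, hx, ?_⟩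
  have := dist_triangle (t⁻¹ • x) w v
  rw [dist_comm] at hd
  linarith

theorem asympCone_smul {n : ℕ} (K : Set (Fin n → ℝ)) {v : Fin n → ℝ} (hv : v ∈ asympCone K)
    {c : ℝ} (hc : 0 < c) : c • v ∈ asympCone K := by
  obtain ⟨t, x, hx, ht, hl⟩ := hv
  refine ⟨fun k => c⁻¹ * t k, x, hx, ht.const_mul_atTop (inv_pos.2 hc), ?_⟩
  have := hl.const_smul c
  refine this.congr fun k => ?_
  rw [smul_smul, mul_inv, inv_inv]

theorem recFn_smul {n : ℕ} (p : MvPolynomial (Fin n) ℝ) (c : ℝ) (x : Fin n → ℝ) :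
    recFn p (c • x) = c ^ p.totalDegree * recFn p x := by
  have h := homogeneousComponent_isHomogeneous p.totalDegree p
  unfold recFn
  rw [eval_eq, eval_eq, Finset.mul_sum]
  refine Finset.sum_congr rfl fun d hd => ?_
  have hdeg : d.degree = p.totalDegree := by
    rw [Finsupp.degree_eq_weight_one]
    exact h (mem_support_iff.1 hd)
  have : ∏ i ∈ d.support, (c • x) i ^ d i = c ^ p.totalDegree * ∏ i ∈ d.support, x i ^ d i := by
    simp only [Pi.smul_apply, smul_eq_mul, mul_pow, Finset.prod_mul_distrib]
    rw [Finset.prod_pow_eq_pow_sum, ← hdeg]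
    rfl
  rw [this]; ring

theorem recFn_zero {n : ℕ} (p : MvPolynomial (Fin n) ℝ) (hp : 1 ≤ p.totalDegree) :
    recFn p 0 = 0 := by
  have := recFn_smul p 0 0
  rwa [zero_pow (by omega), zero_mul, zero_smul] at this

theorem recFn_continuous {n : ℕ} (p : MvPolynomial (Fin n) ℝ) : Continuous (recFn p) :=
  MvPolynomial.continuous_eval _

theorem stmt4 {n s : ℕ} (hs : 0 < s) (K : Set (Fin n → ℝ)) (hK : K.Nonempty) (hKc : IsClosed K)
    (f : Fin s → MvPolynomial (Fin n) ℝ) (hdeg : ∀ i, 1 ≤ (f i).totalDegree) :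
    SOLw (asympCone K) (fun i => recFn (f i)) = {0} ↔
      ∀ i, SOLmin (asympCone K) (recFn (f i)) = {0} := by
  have hz : ∀ i, recFn (f i) 0 = 0 := fun i => recFn_zero _ (hdeg i)
  have hC := isClosed_asympCone K
  have hsm : ∀ v ∈ asympCone K, ∀ c : ℝ, 0 < c → c • v ∈ asympCone K :=
    fun v hv c hc => asympCone_smul K hv hc
  generalize asympCone K = C at *
  constructor
  · intro h
    have h0 : (0 : Fin n → ℝ) ∈ SOLw C (fun i => recFn (f i)) := by rw [h]; rfl
    have huniq : ∀ x ∈ C, (∀ y ∈ C, ¬ ∀ i, recFn (f i) y < recFn (f i) x) → x = 0 := by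
      intro x hx hy
      have : x ∈ SOLw C (fun i => recFn (f i)) := ⟨hx, hy⟩
      rw [h] at this
      exact this
    obtain ⟨h0C, h0m⟩ := h0
    simp only [hz] at h0m
    have hpos : ∀ v ∈ C, v ≠ 0 → ∃ j, 0 < recFn (f j) v := by
      intro v hv hv0
      by_contra! hn
      exact hv0 (huniq v hv fun y hy hlt => h0m y hy fun i => (hlt i).trans_le (hn i))
    -- no negative values
    have hnn : ∀ i, ∀ x ∈ C, 0 ≤ recFn (f i) x := by
      intro i x hx
      by_contra! hneg
      haveI : Nonempty (Fin s) := ⟨i⟩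
      let F : (Fin n → ℝ) → ℝ := fun v =>
        Finset.univ.sup' Finset.univ_nonempty (fun j => recFn (f j) v)
      have hF : Continuous F :=
        Continuous.finset_sup'_apply _ fun j _ => recFn_continuous (f j)
      have hScomp : IsCompact (C ∩ Metric.sphere (0 : Fin n → ℝ) 1) :=
        (isCompact_sphere _ _).inter_left hC
      have heps : ∃ ε > 0, ∀ v ∈ C ∩ Metric.sphere (0 : Fin n → ℝ) 1, ε ≤ F v := by
        rcases (C ∩ Metric.sphere (0 : Fin n → ℝ) 1).eq_empty_or_nonempty with he | hne
        · exact ⟨1, one_pos, by simp [he]⟩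
        · obtain ⟨w, hw, hmin⟩ := hScomp.exists_isMinOn hne hF.continuousOn
          obtain ⟨j, hj⟩ := hpos w hw.1 (by
            rintro rfl
            simpa using hw.2)
          exact ⟨F w, hj.trans_le (Finset.le_sup' (fun j => recFn (f j) w) (Finset.mem_univ j)),
            fun v hv => hmin hv⟩
      obtain ⟨ε, hε, hFε⟩ := heps
      let L : Set (Fin n → ℝ) := C ∩ {y | ∀ j, recFn (f j) y ≤ recFn (f j) x}
      have hLc : IsClosed L := by
        refine hC.inter ?_
        rw [Set.setOf_forall]
        exact isClosed_iInter fun j => isClosed_le (recFn_continuous _) continuous_const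
      let M : ℝ := ∑ j, |recFn (f j) x|
      have hM : ∀ j, recFn (f j) x ≤ M := fun j =>
        (le_abs_self _).trans
          (Finset.single_le_sum (f := fun j => |recFn (f j) x|)
            (fun _ _ => abs_nonneg _) (Finset.mem_univ j))
      have hLb : L ⊆ Metric.closedBall 0 (max 1 (M / ε)) := by
        intro y hy
        rw [mem_closedBall_zero_iff]
        by_contra! hlt
        obtain ⟨h1, h2⟩ := max_lt_iff.1 hlt
        have hn0 : 0 < ‖y‖ := by linarith
        have hv : ‖y‖⁻¹ • y ∈ C ∩ Metric.sphere (0 : Fin n → ℝ) 1 := by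
          refine ⟨hsm y hy.1 _ (inv_pos.2 hn0), ?_⟩
          rw [mem_sphere_zero_iff_norm, norm_smul, norm_inv, norm_norm, inv_mul_cancel₀ hn0.ne']
        obtain ⟨j, -, hj⟩ := (Finset.le_sup'_iff _).1 (hFε _ hv)
        have e : recFn (f j) y = ‖y‖ ^ (f j).totalDegree * recFn (f j) (‖y‖⁻¹ • y) := by
          rw [← recFn_smul, smul_smul, mul_inv_cancel₀ hn0.ne', one_smul]
        have h3 : ‖y‖ ≤ ‖y‖ ^ (f j).totalDegree :=
          le_self_pow₀ h1.le (by have := hdeg j; omega)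
        have h4 : ‖y‖ * ε ≤ recFn (f j) y := by
          rw [e]
          exact mul_le_mul h3 hj hε.le (by positivity)
        have h5 := hy.2 j
        have h6 := hM j
        rw [div_lt_iff₀ hε] at h2
        linarith
      have hLcomp : IsCompact L := (isCompact_closedBall _ _).of_isClosed_subset hLc hLb
      obtain ⟨w, hw, hmin⟩ := hLcomp.exists_isMinOn ⟨x, hx, fun _ => le_rfl⟩
        (recFn_continuous (f i)).continuousOn
      have hw0 : w = 0 := huniq w hw.1 fun y hy hlt => by
        have hyL : y ∈ L := ⟨hy, fun j => (hlt j).le.trans (hw.2 j)⟩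
        have : recFn (f i) w ≤ recFn (f i) y := hmin hyL
        linarith [hlt i]
      have := hw.2 i
      rw [hw0, hz] at this
      linarith
    intro i
    apply Set.eq_singleton_iff_unique_mem.2
    refine ⟨⟨h0C, fun y hy => by rw [hz]; exact hnn i y hy⟩, ?_⟩
    rintro x ⟨hx, hm⟩
    exact huniq x hx fun y hy hlt => absurd (hlt i) (not_lt.2 (hm y hy))
  · intro h
    have h0 : ∀ i, (0 : Fin n → ℝ) ∈ SOLmin C (recFn (f i)) := fun i => by rw [h i]; rfl
    apply Set.eq_singleton_iff_unique_mem.2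
    refine ⟨⟨(h0 ⟨0, hs⟩).1, fun y hy hlt => ?_⟩, ?_⟩
    · exact absurd (hlt ⟨0, hs⟩) (not_lt.2 ((h0 ⟨0, hs⟩).2 y hy))
    · rintro x ⟨hx, hm⟩
      by_contra hx0
      refine hm 0 (h0 ⟨0, hs⟩).1 fun i => ?_
      by_contra! hle
      have : x ∈ SOLmin C (recFn (f i)) := ⟨hx, fun y hy => hle.trans ((h0 i).2 y hy)⟩
      rw [h i] at this
      exact hx0 this
end

section
/- If SOL^w(K_∞, f^∞) = ∅, then the weak Pareto efficient solution set of the original problem is empty: SOL^w(K, f) = ∅. -/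
open Filter Topology MvPolynomial

theorem hom_eval_smul {n m : ℕ} {q : MvPolynomial (Fin n) ℝ} (hq : q.IsHomogeneous m)
    (t : ℝ) (u : Fin n → ℝ) : eval (t • u) q = t ^ m * eval u q := by
  rw [eval_eq', eval_eq', Finset.mul_sum]
  refine Finset.sum_congr rfl fun d hd => ?_
  have h1 := hq (mem_support_iff.1 hd)
  have h2 : ∑ i, d i = m := by
    rw [← h1, Finsupp.weight_apply, Finsupp.sum_fintype _ _ (by simp)]
    simp
  simp only [Pi.smul_apply, smul_eq_mul, mul_pow, Finset.prod_mul_distrib,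
    Finset.prod_pow_eq_pow_sum, h2]
  ring

theorem tendsto_rec {n : ℕ} (p : MvPolynomial (Fin n) ℝ) (t : ℕ → ℝ) (u : ℕ → Fin n → ℝ)
    (v : Fin n → ℝ) (ht : Tendsto t atTop atTop) (hu : Tendsto u atTop (𝓝 v)) :
    Tendsto (fun k => (t k ^ p.totalDegree)⁻¹ * eval (t k • u k) p) atTop (𝓝 (recFn p v)) := by
  have key : ∀ i ∈ Finset.range (p.totalDegree + 1),
      Tendsto (fun k => (t k ^ p.totalDegree)⁻¹ * eval (t k • u k) (homogeneousComponent i p)) atTop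
        (𝓝 (if i = p.totalDegree then recFn p v else 0)) := by
    intro i hi
    have hc : Tendsto (fun k => eval (u k) (homogeneousComponent i p)) atTop
        (𝓝 (eval v (homogeneousComponent i p))) :=
      ((MvPolynomial.continuous_eval (homogeneousComponent i p)).tendsto v).comp hu
    split_ifs with h
    · subst h
      refine hc.congr' ?_
      filter_upwards [ht.eventually_gt_atTop 0] with k hk
      rw [hom_eval_smul (homogeneousComponent_isHomogeneous _ p), ← mul_assoc,
        inv_mul_cancel₀ (by positivity), one_mul]
    · have hlt : i < p.totalDegree := by
        have := Finset.mem_range.1 hi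
        omega
      have h0 : Tendsto (fun k => (t k ^ (p.totalDegree - i))⁻¹) atTop (𝓝 0) :=
        tendsto_inv_atTop_zero.comp ((tendsto_pow_atTop (by omega)).comp ht)
      have h1 := h0.mul hc
      rw [zero_mul] at h1
      refine h1.congr' ?_
      filter_upwards [ht.eventually_gt_atTop 0] with k hk
      rw [hom_eval_smul (homogeneousComponent_isHomogeneous _ p), ← mul_assoc]
      congr 1
      have h2 : t k ^ p.totalDegree = t k ^ (p.totalDegree - i) * t k ^ i := by
        rw [← pow_add]
        congr 1
        omega
      rw [h2]
      field_simp
  have hsum := tendsto_finsetSum _ key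
  rw [Finset.sum_ite_eq' , if_pos (Finset.mem_range.2 (Nat.lt_succ_self _))] at hsum
  refine hsum.congr fun k => ?_
  rw [← Finset.mul_sum, ← map_sum, sum_homogeneousComponent]

theorem stmt12 {n s : ℕ} (hs : 0 < s) (K : Set (Fin n → ℝ)) (hK : K.Nonempty) (hKc : IsClosed K)
    (f : Fin s → MvPolynomial (Fin n) ℝ) (hdeg : ∀ i, 1 ≤ (f i).totalDegree)
    (h : SOLw (asympCone K) (fun i => recFn (f i)) = ∅) :
    SOLw K (fun i => evalFn (f i)) = ∅ := by
  ext xs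
  simp only [Set.mem_empty_iff_false, iff_false]
  rintro ⟨-, hx⟩
  have h0 : (0 : Fin n → ℝ) ∈ asympCone K := by
    obtain ⟨a, ha⟩ := hK
    refine ⟨fun k => (k : ℝ), fun _ => a, fun _ => ha, tendsto_natCast_atTop_atTop, ?_⟩
    have := (tendsto_inv_atTop_zero.comp (tendsto_natCast_atTop_atTop (R := ℝ))).smul_const a
    simpa using this
  have h1 : (0 : Fin n → ℝ) ∉ SOLw (asympCone K) (fun i => recFn (f i)) := by
    rw [h]
    exact Set.notMem_empty _
  have h2 : ∃ v ∈ asympCone K, ∀ i, recFn (f i) v < recFn (f i) 0 := by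
    by_contra hcon
    exact h1 ⟨h0, fun y hy hlt => hcon ⟨y, hy, hlt⟩⟩
  obtain ⟨v, ⟨t, x, hxK, ht, hxv⟩, hv⟩ := h2
  have h3 : ∀ i, ∀ᶠ k in atTop, evalFn (f i) (x k) < evalFn (f i) xs := by
    intro i
    have hz : recFn (f i) 0 = 0 := by
      have := hom_eval_smul (homogeneousComponent_isHomogeneous (f i).totalDegree (f i)) 0 0
      rw [zero_smul, zero_pow (by have := hdeg i; omega), zero_mul] at this
      exact this
    have hvi : recFn (f i) v < 0 := by
      have := hv i
      rwa [hz] at this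
    have hA := tendsto_rec (f i) t _ v ht hxv
    have hB : Tendsto (fun k => (t k ^ (f i).totalDegree)⁻¹ * evalFn (f i) xs) atTop (𝓝 0) := by
      have hB0 : Tendsto (fun k => (t k ^ (f i).totalDegree)⁻¹) atTop (𝓝 0) :=
        tendsto_inv_atTop_zero.comp
          ((tendsto_pow_atTop (by have := hdeg i; omega)).comp ht)
      simpa using hB0.mul_const (evalFn (f i) xs)
    filter_upwards [hA.eventually_lt hB hvi, ht.eventually_gt_atTop 0] with k hk hk0
    rw [smul_inv_smul₀ hk0.ne'] at hk
    exact lt_of_mul_lt_mul_left hk (by positivity)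
  obtain ⟨k, hk⟩ := (eventually_all.2 h3).exists
  exact hx (x k) (hxK k) hk
end
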